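/- Let λ_* > 0 and let β* ∈ ℝᵖ satisfy ‖β*‖₁ ≥ ‖β⁰‖₁ (in particular this holds for the ℓ₁-restricted oracle β* := argmin{ ‖X(β−β⁰)‖_n² + λ_*²|S_β|/φ̂²(L,S_β) : ‖β‖₁ ≥ ‖β⁰‖₁ }). Let S_* := {j : β*_j ≠ 0} and assume φ̂(1,S_*) > 0. Then λ_* ‖β* − β⁰‖₁ ≤ ‖X(β* − β⁰)‖_n² + λ_*² |S_*| / φ̂²(1,S_*). -/

import Mathlib

open Finset Matrix

/-- `‖v‖_n = √(vᵀv/n)`. -/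
noncomputable def normN {n : ℕ} (v : Fin n → ℝ) : ℝ :=
  Real.sqrt ((∑ i, v i ^ 2) / n)

/-- `ℓ₁`-norm of a vector. -/
noncomputable def l1norm {p : ℕ} (v : Fin p → ℝ) : ℝ := ∑ j, |v j|

/-- `ℓ_∞`-norm of a vector. -/
noncomputable def lsup {p : ℕ} (v : Fin p → ℝ) : ℝ := ⨆ j, |v j|

/-- `β_S`: the vector `β` with entries outside `S` set to zero. -/
def sub0 {p : ℕ} (S : Finset (Fin p)) (β : Fin p → ℝ) : Fin p → ℝ :=
  fun j => if j ∈ S then β j else 0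

/-- The compatibility constant squared `φ̂²(L,S)`. -/
noncomputable def compatSq {n p : ℕ} (X : Matrix (Fin n) (Fin p) ℝ) (L : ℝ)
    (S : Finset (Fin p)) : ℝ :=
  sInf { r | ∃ β : Fin p → ℝ, l1norm (sub0 S β) = 1 ∧ l1norm (sub0 Sᶜ β) ≤ L ∧
    r = S.card * (normN (X.mulVec (sub0 S β) - X.mulVec (sub0 Sᶜ β))) ^ 2 }

/-- `‖v‖_n²` is the mean of squares. -/
lemma normN_sq {n : ℕ} (v : Fin n → ℝ) : normN v ^ 2 = (∑ i, v i ^ 2) / n :=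
  Real.sq_sqrt (div_nonneg (sum_nonneg fun _ _ => sq_nonneg _) n.cast_nonneg)

lemma normN_smul_sq {n : ℕ} (c : ℝ) (v : Fin n → ℝ) :
    normN (c • v) ^ 2 = c ^ 2 * normN v ^ 2 := by
  simp only [normN_sq, Pi.smul_apply, smul_eq_mul, mul_pow, ← mul_sum, mul_div_assoc]

lemma l1norm_nonneg {p : ℕ} (v : Fin p → ℝ) : 0 ≤ l1norm v :=
  sum_nonneg fun _ _ => abs_nonneg _

lemma l1norm_smul {p : ℕ} (c : ℝ) (v : Fin p → ℝ) : l1norm (c • v) = |c| * l1norm v := by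
  simp only [l1norm, Pi.smul_apply, smul_eq_mul, abs_mul, ← mul_sum]

lemma l1norm_sub0 {p : ℕ} (S : Finset (Fin p)) (v : Fin p → ℝ) :
    l1norm (sub0 S v) = ∑ j ∈ S, |v j| := by
  simp [l1norm, sub0, apply_ite abs, Finset.sum_ite_mem]

lemma l1norm_eq_add_compl {p : ℕ} (S : Finset (Fin p)) (v : Fin p → ℝ) :
    l1norm v = l1norm (sub0 S v) + l1norm (sub0 Sᶜ v) := by
  rw [l1norm_sub0, l1norm_sub0, Finset.sum_add_sum_compl, l1norm]

/-- The compatibility inequality on the cone `‖δ_{Sᶜ}‖₁ ≤ L ‖δ_S‖₁`. -/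
lemma compatSq_mul_sq_le {n p : ℕ} (X : Matrix (Fin n) (Fin p) ℝ) {L : ℝ}
    (S : Finset (Fin p)) (δ : Fin p → ℝ)
    (hcone : l1norm (sub0 Sᶜ δ) ≤ L * l1norm (sub0 S δ)) :
    compatSq X L S * l1norm (sub0 S δ) ^ 2 ≤ S.card * normN (X.mulVec δ) ^ 2 := by
  rcases (l1norm_nonneg (sub0 S δ)).eq_or_lt with h0 | hpos
  · rw [← h0]
    simp only [ne_eq, OfNat.ofNat_ne_zero, not_false_eq_true, zero_pow, mul_zero]
    positivity
  set t := l1norm (sub0 S δ) with ht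
  let β : Fin p → ℝ := fun j => if j ∈ S then t⁻¹ * δ j else -(t⁻¹ * δ j)
  have hS : sub0 S β = t⁻¹ • sub0 S δ := by
    ext j
    by_cases hj : j ∈ S <;> simp [sub0, β, hj]
  have hSc : sub0 Sᶜ β = (-t⁻¹) • sub0 Sᶜ δ := by
    ext j
    by_cases hj : j ∈ S <;> simp [sub0, β, hj]
  have hdiff : sub0 S β - sub0 Sᶜ β = t⁻¹ • δ := by
    ext j
    by_cases hj : j ∈ S <;> simp [sub0, β, hj]
  have hle : compatSq X L S ≤
      S.card * normN (X.mulVec (sub0 S β) - X.mulVec (sub0 Sᶜ β)) ^ 2 := by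
    refine csInf_le ⟨0, ?_⟩ ⟨β, ?_, ?_, rfl⟩
    · rintro r ⟨γ, -, -, rfl⟩
      positivity
    · rw [hS, l1norm_smul, abs_of_pos (inv_pos.2 hpos), ← ht, inv_mul_cancel₀ hpos.ne']
    · rw [hSc, l1norm_smul, abs_neg, abs_of_pos (inv_pos.2 hpos), inv_mul_le_iff₀ hpos]
      linarith
  rw [← Matrix.mulVec_sub, hdiff, Matrix.mulVec_smul, normN_smul_sq] at hle
  calc compatSq X L S * t ^ 2
      ≤ S.card * (t⁻¹ ^ 2 * normN (X.mulVec δ) ^ 2) * t ^ 2 := by gcongr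
    _ = S.card * normN (X.mulVec δ) ^ 2 := by field_simp

/-- If `β` is supported on `S` and `‖β₀‖₁ ≤ ‖β‖₁`, then `β - β₀` lies in the cone
`‖δ_{Sᶜ}‖₁ ≤ ‖δ_S‖₁`. -/
lemma l1norm_sub0_compl_sub_le {p : ℕ} {S : Finset (Fin p)} {β β₀ : Fin p → ℝ}
    (hβ : ∀ j ∉ S, β j = 0) (hle : l1norm β₀ ≤ l1norm β) :
    l1norm (sub0 Sᶜ (β - β₀)) ≤ l1norm (sub0 S (β - β₀)) := by
  rw [l1norm_eq_add_compl S β, l1norm_eq_add_compl S β₀] at hle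
  simp only [l1norm_sub0, Pi.sub_apply] at hle ⊢
  have hβc : ∑ j ∈ Sᶜ, |β j| = 0 :=
    sum_eq_zero fun j hj => by rw [hβ j (mem_compl.1 hj), abs_zero]
  have hδc : ∑ j ∈ Sᶜ, |β j - β₀ j| = ∑ j ∈ Sᶜ, |β₀ j| :=
    sum_congr rfl fun j hj => by rw [hβ j (mem_compl.1 hj), zero_sub, abs_neg]
  have htri : ∑ j ∈ S, |β j| - ∑ j ∈ S, |β₀ j| ≤ ∑ j ∈ S, |β j - β₀ j| := by
    rw [← sum_sub_distrib]
    exact sum_le_sum fun j _ => abs_sub_abs_le_abs_sub _ _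
  linarith

theorem ell1_restricted_oracle
    {n p : ℕ} (X : Matrix (Fin n) (Fin p) ℝ)
    (β0 : Fin p → ℝ)
    (lamstar : ℝ) (hlamstar : 0 < lamstar)
    (βstar : Fin p → ℝ) (hβstar : l1norm βstar ≥ l1norm β0)
    (Sstar : Finset (Fin p)) (hSstar : ∀ j, j ∈ Sstar ↔ βstar j ≠ 0)
    (hφ : 0 < compatSq X 1 Sstar) :
    lamstar * l1norm (βstar - β0) ≤
      (normN (X.mulVec (βstar - β0))) ^ 2 +
        lamstar ^ 2 * Sstar.card / compatSq X 1 Sstar := by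
  have hcone := l1norm_sub0_compl_sub_le (S := Sstar)
    (fun j hj => not_not.1 fun h => hj ((hSstar j).2 h)) hβstar
  have hcompat := compatSq_mul_sq_le X (L := 1) Sstar (βstar - β0) (by rwa [one_mul])
  rw [l1norm_eq_add_compl Sstar, mul_div_assoc]
  set t := l1norm (sub0 Sstar (βstar - β0))
  set N := normN (X.mulVec (βstar - β0))
  set a := (Sstar.card : ℝ) / compatSq X 1 Sstar with ha
  have ha0 : 0 ≤ a := by positivity
  have ht : t ^ 2 ≤ a * N ^ 2 := by
    rw [ha, div_mul_eq_mul_div, le_div_iff₀ hφ]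
    linarith
  calc lamstar * (t + l1norm (sub0 Sstarᶜ (βstar - β0))) ≤ 2 * lamstar * t := by
        linarith [mul_le_mul_of_nonneg_left hcone hlamstar.le]
    _ ≤ N ^ 2 + lamstar ^ 2 * a := by
        refine (abs_le_of_sq_le_sq' ?_ (by positivity)).2
        linarith [sq_nonneg (N ^ 2 - lamstar ^ 2 * a),
          mul_le_mul_of_nonneg_left ht (sq_nonneg lamstar)]
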